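/- The unary acyclic conjunctive query T'(x) :- P(x) ∧ R(y_1,y_2) ∧ R(y_2,y_3) ∧ R(y_3,y_4) ∧ R(y_4,y_5) (over a schema with a unary relation P and a binary relation R) is not uniquely characterizable, with respect to the class of unary acyclic conjunctive queries, by any finite set of acyclic positive and negative examples. -/

import Mathlib

/-- A finite relational structure over a schema `S` (with arity function `ar`)
with `k` distinguished elements. -/
structure PStruct (S : Type) (ar : S → ℕ) (k : ℕ) : Type 1 where
  dom : Type
  finite : Finite dom
  facts : ∀ R : S, Set (Fin (ar R) → dom)
  dist : Fin k → dom

attribute [instance] PStruct.finite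

namespace PStruct

variable {S : Type} {ar : S → ℕ} {k : ℕ}

/-- `h` is a homomorphism from `A` to `B`: it preserves all facts and maps
distinguished elements to corresponding distinguished elements. -/
def IsHom (A B : PStruct S ar k) (h : A.dom → B.dom) : Prop :=
  (∀ (R : S) (t : Fin (ar R) → A.dom), t ∈ A.facts R → (fun i => h (t i)) ∈ B.facts R) ∧
  ∀ i : Fin k, h (A.dist i) = B.dist i

/-- `(A,𝐚) → (B,𝐛)`: a homomorphism exists. -/
def HomTo (A B : PStruct S ar k) : Prop := ∃ h, IsHom A B h

/-- Homomorphic equivalence. -/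
def HomEquiv (A B : PStruct S ar k) : Prop := HomTo A B ∧ HomTo B A

/-- Direct product of two structures with distinguished elements. -/
def prod (A B : PStruct S ar k) : PStruct S ar k where
  dom := A.dom × B.dom
  finite := inferInstance
  facts R := {t | (fun i => (t i).1) ∈ A.facts R ∧ (fun i => (t i).2) ∈ B.facts R}
  dist i := (A.dist i, B.dist i)

/-- The facts of a structure, as a type. -/
def Fact (A : PStruct S ar k) : Type := Σ R : S, {t : Fin (ar R) → A.dom // t ∈ A.facts R}

/-- Occurrences of elements in facts: a fact together with a position in it. -/
def Occ (A : PStruct S ar k) : Type :=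
  Σ R : S, {t : Fin (ar R) → A.dom // t ∈ A.facts R} × Fin (ar R)

def Occ.fact {A : PStruct S ar k} (o : Occ A) : Fact A := ⟨o.1, o.2.1⟩

def Occ.elem {A : PStruct S ar k} (o : Occ A) : A.dom := o.2.1.1 o.2.2

/-- Vertices of the (subdivided) incidence graph: elements, occurrences, and facts.
Each occurrence vertex subdivides one edge of the bipartite incidence multigraph,
so that cycles (resp. connectivity) of the incidence multigraph correspond exactly to
cycles (resp. connectivity) of this simple graph. -/
def IncV (A : PStruct S ar k) : Type := A.dom ⊕ (Occ A ⊕ Fact A)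

/-- The incidence graph of a structure, as a simple graph (with each
element-occurrence-in-a-fact edge of the incidence multigraph subdivided). -/
def incGraph (A : PStruct S ar k) : SimpleGraph (IncV A) where
  Adj v w := ∃ o : Occ A,
    (v = Sum.inl o.elem ∧ w = Sum.inr (Sum.inl o)) ∨
    (w = Sum.inl o.elem ∧ v = Sum.inr (Sum.inl o)) ∨
    (v = Sum.inr (Sum.inl o) ∧ w = Sum.inr (Sum.inr o.fact)) ∨
    (w = Sum.inr (Sum.inl o) ∧ v = Sum.inr (Sum.inr o.fact))
  symm := by
    refine ⟨?_⟩
    rintro v w ⟨o, h⟩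
    exact ⟨o, by tauto⟩
  loopless := by
    refine ⟨?_⟩
    rintro v ⟨o, (⟨h1, h2⟩ | ⟨h1, h2⟩ | ⟨h1, h2⟩ | ⟨h1, h2⟩)⟩ <;> rw [h1] at h2 <;>
      first
      | exact Sum.inl_ne_inr h2
      | exact Sum.inl_ne_inr (Sum.inr.inj h2)

/-- A structure is acyclic if its incidence graph is acyclic (Berge acyclicity). -/
def Acyclic (A : PStruct S ar k) : Prop := (incGraph A).IsAcyclic

/-- A structure is c-acyclic if every cycle of its incidence graph passes through
a distinguished element. -/
def CAcyclic (A : PStruct S ar k) : Prop :=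
  ∀ (v : IncV A) (c : (incGraph A).Walk v v), c.IsCycle →
    ∃ i : Fin k, Sum.inl (A.dist i) ∈ c.support

/-- A structure is c-connected if every connected component of its incidence graph
contains a distinguished element. -/
def CConnected (A : PStruct S ar k) : Prop :=
  ∀ v : IncV A, ∃ i : Fin k, (incGraph A).Reachable (Sum.inl (A.dist i)) v

/-- The incidence graph is connected. -/
def IncConnected (A : PStruct S ar k) : Prop := (incGraph A).Connected

/-- The fact graph: vertices are facts, with an edge between distinct facts that
share a non-distinguished element. -/
def factGraph (A : PStruct S ar k) : SimpleGraph (Fact A) where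
  Adj f g := f ≠ g ∧ ∃ b : A.dom, (∀ i, b ≠ A.dist i) ∧ (∃ j, f.2.1 j = b) ∧ (∃ j, g.2.1 j = b)
  symm := by
    refine ⟨?_⟩
    rintro f g ⟨hne, b, h1, h2, h3⟩
    exact ⟨hne.symm, b, h1, h3, h2⟩
  loopless := by refine ⟨?_⟩; rintro f ⟨hne, -⟩; exact hne rfl

/-- A structure is fg-connected if its fact graph is connected. -/
def FgConnected (A : PStruct S ar k) : Prop := (factGraph A).Connected

/-- A structure is a core if it admits no homomorphism to a proper substructure,
i.e. every endomorphism is surjective on elements and on facts. -/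
def IsCore (A : PStruct S ar k) : Prop :=
  ∀ h : A.dom → A.dom, IsHom A A h →
    Function.Surjective h ∧
    ∀ (R : S) (t : Fin (ar R) → A.dom), t ∈ A.facts R →
      ∃ s ∈ A.facts R, (fun i => h (s i)) = t

/-- Unique Names Property: the distinguished elements are pairwise distinct. -/
def UNP (A : PStruct S ar k) : Prop := Function.Injective A.dist

/-- A structure is safe if every distinguished element occurs in at least one fact. -/
def Safe (A : PStruct S ar k) : Prop :=
  ∀ i : Fin k, ∃ (R : S) (t : Fin (ar R) → A.dom), t ∈ A.facts R ∧ ∃ j, t j = A.dist i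

/-- A structure is (the canonical structure of) a conjunctive query iff every element
occurs in at least one fact (in particular it is safe). -/
def IsCQ (A : PStruct S ar k) : Prop :=
  ∀ x : A.dom, ∃ (R : S) (t : Fin (ar R) → A.dom), t ∈ A.facts R ∧ ∃ j, t j = x

/-- The size of a structure: its number of facts. -/
noncomputable def size (A : PStruct S ar k) : ℕ := Nat.card (Fact A)

/-- The total size of a set of structures: the sum of (size + 1) over its members. -/
noncomputable def totalSize (F : Set (PStruct S ar k)) : ℕ := ∑ᶠ B ∈ F, (size B + 1)

/-- `F` is a frontier for `A` with respect to the class `C`. -/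
def IsFrontier (C : Set (PStruct S ar k)) (A : PStruct S ar k)
    (F : Set (PStruct S ar k)) : Prop :=
  F.Finite ∧
  (∀ B ∈ F, HomTo B A) ∧
  (∀ B ∈ F, ¬ HomTo A B) ∧
  ∀ C' ∈ C, HomTo C' A → ¬ HomTo A C' → ∃ B ∈ F, HomTo C' B

/-- `D` is a finite duality for `A` with respect to the class `C`. -/
def IsDuality (C : Set (PStruct S ar k)) (A : PStruct S ar k)
    (D : Set (PStruct S ar k)) : Prop :=
  D.Finite ∧ ∀ C' ∈ C, (HomTo A C' ↔ ∀ B ∈ D, ¬ HomTo C' B)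

/-- A conjunctive query (given by its canonical structure `Q`) fits the example sets
`(E⁺, E⁻)`: every example in `E⁺` is positive and every example in `E⁻` is negative.
(By Chandra–Merlin, `(A,𝐚)` is a positive example for `Q` iff `Q → (A,𝐚)`.) -/
def Fits (Q : PStruct S ar k) (Ep Em : Set (PStruct S ar k)) : Prop :=
  (∀ E ∈ Ep, HomTo Q E) ∧ (∀ E ∈ Em, ¬ HomTo Q E)

/-- `(E⁺, E⁻)` uniquely characterizes the CQ `Q` with respect to the class `C` of CQs
(all represented by their canonical structures): `Q` fits, and every member of `C`
that fits is logically equivalent (i.e. homomorphically equivalent) to `Q`. -/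
def UniquelyCharacterizes (Ep Em : Set (PStruct S ar k)) (Q : PStruct S ar k)
    (C : Set (PStruct S ar k)) : Prop :=
  Fits Q Ep Em ∧ ∀ Q' ∈ C, Fits Q' Ep Em → HomEquiv Q Q'

end PStruct

open PStruct

/-- The schema with one unary relation `P` and one binary relation `R`. -/
inductive Sch15 : Type
  | P : Sch15
  | R : Sch15

@[reducible] def arSch15 : Sch15 → ℕ
  | .P => 1
  | .R => 2

/-- The unary acyclic query `T'(x) :- P(x) ∧ R(y₁,y₂) ∧ R(y₂,y₃) ∧ R(y₃,y₄) ∧ R(y₄,y₅)`,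
represented by its canonical structure (`x = 0`, `yᵢ = i : Fin 6`). -/
def Tq' : PStruct Sch15 arSch15 1 where
  dom := Fin 6
  finite := inferInstance
  facts Rl := match Rl with
    | .P => {t | t 0 = 0}
    | .R => {t | (t 0 = 1 ∧ t 1 = 2) ∨ (t 0 = 2 ∧ t 1 = 3) ∨
                 (t 0 = 3 ∧ t 1 = 4) ∨ (t 0 = 4 ∧ t 1 = 5)}
  dist _ := 0


/-! ### Graph-theoretic helpers -/

theorem acyclic_of_rank {V : Type*} (G : SimpleGraph V) (f : V → ℕ)
    (h1 : ∀ u v, G.Adj u v → f u ≠ f v)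
    (h2 : ∀ u v w, G.Adj u v → G.Adj u w → f v < f u → f w < f u → v = w) :
    G.IsAcyclic := by
  classical
  intro a c hc
  obtain ⟨u, hu, hmax⟩ := Finset.exists_max_image c.support.toFinset f
    ⟨a, by simp⟩
  rw [List.mem_toFinset] at hu
  have hc' := hc.rotate hu
  have hmax' : ∀ w ∈ (c.rotate u hu).support, f w ≤ f u := by
    intro w hw
    apply hmax
    rw [List.mem_toFinset]
    simpa using hw
  have hn : ¬ (c.rotate u hu).Nil := hc'.not_nil
  have ha := (c.rotate u hu).adj_snd hn
  have hb := ((c.rotate u hu).adj_penultimate hn).symm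
  refine hc'.snd_ne_penultimate (h2 u _ _ ha hb ?_ ?_)
  · exact lt_of_le_of_ne (hmax' _ (SimpleGraph.Walk.getVert_mem_support _ _)) (h1 _ _ ha).symm
  · exact lt_of_le_of_ne (hmax' _ (SimpleGraph.Walk.getVert_mem_support _ _)) (h1 _ _ hb).symm

theorem exists_walk_of_seq {V : Type*} (G : SimpleGraph V) (N : ℕ) (v : ℕ → V)
    (h : ∀ i < N, G.Adj (v i) (v (i + 1))) :
    ∃ p : G.Walk (v 0) (v N), p.edges = (List.range N).map (fun i => s(v i, v (i + 1))) := by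
  induction N with
  | zero => exact ⟨.nil, by simp⟩
  | succ N ih =>
    obtain ⟨p, hp⟩ := ih (fun i hi => h i (by omega))
    refine ⟨p.concat (h N (by omega)), ?_⟩
    rw [SimpleGraph.Walk.edges_concat, hp, List.range_succ]
    simp

theorem seq_lt_card {V : Type*} [Finite V] (G : SimpleGraph V) (hG : G.IsAcyclic) (N : ℕ)
    (v : ℕ → V) (h : ∀ i < N, G.Adj (v i) (v (i + 1)))
    (h2 : ∀ i, i + 1 < N → v i ≠ v (i + 2)) : N < Nat.card V := by
  have := Fintype.ofFinite V
  obtain ⟨p, hp⟩ := exists_walk_of_seq G N v h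
  have hpath : p.IsPath := by
    rw [hG.isPath_iff_isChain, hp, List.isChain_iff_getElem]
    intro i hi
    simp only [List.length_map, List.length_range] at hi
    simp only [List.getElem_map, List.getElem_range]
    have := h2 i hi
    have := (h i (by omega)).ne
    grind [Sym2.eq_iff]
  have := hpath.length_lt
  rw [← SimpleGraph.Walk.length_edges, hp] at this
  simpa using this

/-! ### The approximating trees -/

/-- Edge relation of the tree on `ℕ`. -/
def EE (a b : ℕ) : Prop :=
  (a % 8 = 3 ∧ b + 1 = a) ∨ (a % 8 = 2 ∧ b + 2 = a) ∨ (a % 8 = 0 ∧ b = a + 1) ∨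
  (a % 8 = 4 ∧ b + 3 = a) ∨ (a % 8 = 6 ∧ b = a + 1) ∨ (a % 8 = 4 ∧ b = a + 2) ∨
  (a % 8 = 5 ∧ b + 1 = a) ∨ (a % 8 = 5 ∧ b = a + 3)

theorem EE_parent {a b c : ℕ} (h1 : EE b a ∨ EE a b) (h2 : EE c a ∨ EE a c) (hb : b < a)
    (hc : c < a) : b = c := by
  unfold EE at *; omega

theorem EE_ne {a b : ℕ} (h : EE a b) : a ≠ b := by
  unfold EE at *; omega

theorem EE_asymm {a b : ℕ} (h : EE a b) (h' : EE b a) : False := by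
  unfold EE at *; omega

/-- The approximating query. -/
def DD (m : ℕ) : PStruct Sch15 arSch15 1 where
  dom := Option (Fin m)
  finite := inferInstance
  facts Rl := match Rl with
    | .P => {t | t 0 = none}
    | .R => {t | ∃ a b : Fin m, t 0 = some a ∧ t 1 = some b ∧ EE a b}
  dist _ := none

theorem DD_isCQ (n : ℕ) : IsCQ (DD (4 * n + 4)) := by
  intro x
  match x with
  | none => exact ⟨.P, fun _ => none, rfl, 0, rfl⟩
  | some ⟨a, ha⟩ =>
    have key : (∃ b, b < 4 * n + 4 ∧ EE a b) ∨ (∃ b, b < 4 * n + 4 ∧ EE b a) := by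
      have : a % 8 < 8 := Nat.mod_lt _ (by norm_num)
      by_cases h0 : a % 8 = 0
      · exact .inl ⟨a + 1, by omega, by unfold EE; omega⟩
      by_cases h1 : a % 8 = 1
      · exact .inr ⟨a - 1, by omega, by unfold EE; omega⟩
      by_cases h2 : a % 8 = 2
      · exact .inl ⟨a - 2, by omega, by unfold EE; omega⟩
      by_cases h3 : a % 8 = 3
      · exact .inl ⟨a - 1, by omega, by unfold EE; omega⟩
      by_cases h4 : a % 8 = 4
      · exact .inl ⟨a + 2, by omega, by unfold EE; omega⟩
      by_cases h5 : a % 8 = 5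
      · exact .inl ⟨a - 1, by omega, by unfold EE; omega⟩
      by_cases h6 : a % 8 = 6
      · exact .inl ⟨a + 1, by omega, by unfold EE; omega⟩
      · exact .inr ⟨a - 1, by omega, by unfold EE; omega⟩
    rcases key with ⟨b, hb, h⟩ | ⟨b, hb, h⟩
    · exact ⟨.R, ![some ⟨a, ha⟩, some ⟨b, hb⟩], ⟨⟨a, ha⟩, ⟨b, hb⟩, rfl, rfl, h⟩, (0 : Fin 2), rfl⟩
    · exact ⟨.R, ![some ⟨b, hb⟩, some ⟨a, ha⟩], ⟨⟨b, hb⟩, ⟨a, ha⟩, rfl, rfl, h⟩, (1 : Fin 2), rfl⟩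

theorem EE_mod {a b : ℕ} (h : EE a b) :
    (a % 8 = 3 ∧ b % 8 = 2) ∨ (a % 8 = 2 ∧ b % 8 = 0) ∨ (a % 8 = 0 ∧ b % 8 = 1) ∨
    (a % 8 = 4 ∧ b % 8 = 1) ∨ (a % 8 = 6 ∧ b % 8 = 7) ∨ (a % 8 = 4 ∧ b % 8 = 6) ∨
    (a % 8 = 5 ∧ b % 8 = 4) ∨ (a % 8 = 5 ∧ b % 8 = 0) := by
  rcases h with h | h | h | h | h | h | h | h
  · exact .inl (by omega)
  · exact .inr (.inl (by omega))
  · exact .inr (.inr (.inl (by omega)))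
  · exact .inr (.inr (.inr (.inl (by omega))))
  · exact .inr (.inr (.inr (.inr (.inl (by omega)))))
  · exact .inr (.inr (.inr (.inr (.inr (.inl (by omega))))))
  · exact .inr (.inr (.inr (.inr (.inr (.inr (.inl (by omega)))))))
  · exact .inr (.inr (.inr (.inr (.inr (.inr (.inr (by omega)))))))

/-- Level of a vertex. -/
def lev (a : ℕ) : Fin 6 :=
  match a % 8 with
  | 0 => 3 | 1 => 4 | 2 => 2 | 3 => 1 | 4 => 3 | 5 => 2 | 6 => 4 | _ => 5

theorem DD_to_Tq (m : ℕ) : HomTo (DD m) Tq' := by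
  refine ⟨fun x => match x with | none => (0 : Fin 6) | some a => lev a, ?_, fun _ => rfl⟩
  intro Rl t ht
  cases Rl with
  | P =>
    have : t 0 = none := ht
    change _ = _
    simp only [this]
  | R =>
    obtain ⟨⟨a, ha⟩, ⟨b, hb⟩, h0, h1, h⟩ := ht
    have key : (lev a = 1 ∧ lev b = 2) ∨ (lev a = 2 ∧ lev b = 3) ∨
                 (lev a = 3 ∧ lev b = 4) ∨ (lev a = 4 ∧ lev b = 5) := by
      unfold lev
      have : (a % 8 = 3 ∧ b % 8 = 2) ∨ (a % 8 = 2 ∧ b % 8 = 0) ∨ (a % 8 = 0 ∧ b % 8 = 1) ∨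
        (a % 8 = 4 ∧ b % 8 = 1) ∨ (a % 8 = 6 ∧ b % 8 = 7) ∨ (a % 8 = 4 ∧ b % 8 = 6) ∨
        (a % 8 = 5 ∧ b % 8 = 4) ∨ (a % 8 = 5 ∧ b % 8 = 0) := by
        exact EE_mod h
      rcases this with h | h | h | h | h | h | h | h <;> simp [h.1, h.2]
    change (_ ∧ _) ∨ (_ ∧ _) ∨ (_ ∧ _) ∨ (_ ∧ _)
    simp only [h0, h1]
    exact key

theorem no_four {a b c d e : ℕ} (h1 : EE a b) (h2 : EE b c) (h3 : EE c d) (h4 : EE d e) :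
    False := by
  have key : ∃ f : ℕ → ℕ, (∀ x, f x ≤ 3) ∧ ∀ x y, EE x y → f y < f x := by
    refine ⟨fun x => if x % 8 = 1 ∨ x % 8 = 7 then 0 else if x % 8 = 6 ∨ x % 8 = 0 then 1 else
      if x % 8 = 2 ∨ x % 8 = 4 then 2 else 3, ?_, ?_⟩
    · intro x; dsimp only; split_ifs <;> omega
    · intro x y h; unfold EE at h; dsimp only; split_ifs <;> omega
  obtain ⟨f, hf, hlt⟩ := key
  have := hlt _ _ h1
  have := hlt _ _ h2
  have := hlt _ _ h3
  have := hlt _ _ h4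
  have := hf a
  omega

theorem not_Tq_to_DD (m : ℕ) : ¬ HomTo Tq' (DD m) := by
  rintro ⟨h, hh, -⟩
  have e1 := hh .R ![(1 : Fin 6), (2 : Fin 6)] (Or.inl ⟨rfl, rfl⟩)
  have e2 := hh .R ![(2 : Fin 6), (3 : Fin 6)] (Or.inr (Or.inl ⟨rfl, rfl⟩))
  have e3 := hh .R ![(3 : Fin 6), (4 : Fin 6)] (Or.inr (Or.inr (Or.inl ⟨rfl, rfl⟩)))
  have e4 := hh .R ![(4 : Fin 6), (5 : Fin 6)] (Or.inr (Or.inr (Or.inr ⟨rfl, rfl⟩)))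
  obtain ⟨a, b, ha, hb, h1⟩ := e1
  obtain ⟨b', c, hb', hc, h2⟩ := e2
  obtain ⟨c', d, hc', hd, h3⟩ := e3
  obtain ⟨d', e, hd', he, h4⟩ := e4
  obtain rfl : b = b' := Option.some.inj (hb.symm.trans hb')
  obtain rfl : c = c' := Option.some.inj (hc.symm.trans hc')
  obtain rfl : d = d' := Option.some.inj (hd.symm.trans hd')
  exact no_four h1 h2 h3 h4

/-- A directed path of length four gives a homomorphism from `T'`. -/
theorem Tq_to {E : PStruct Sch15 arSch15 1} (hP : (fun _ => E.dist 0) ∈ E.facts .P)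
    {a b c d e : E.dom} (h1 : (![a, b] : Fin 2 → E.dom) ∈ E.facts .R)
    (h2 : (![b, c] : Fin 2 → E.dom) ∈ E.facts .R)
    (h3 : (![c, d] : Fin 2 → E.dom) ∈ E.facts .R)
    (h4 : (![d, e] : Fin 2 → E.dom) ∈ E.facts .R) : HomTo Tq' E := by
  refine ⟨(![E.dist 0, a, b, c, d, e] : Fin 6 → E.dom), ?_, ?_⟩
  · intro Rl t ht
    cases Rl with
    | P =>
      have h0 : t 0 = (0 : Fin 6) := ht
      convert hP using 1
      funext i
      obtain rfl : i = 0 := Subsingleton.elim (α := Fin 1) _ _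
      rw [h0]; rfl
    | R =>
      have ext2 : ∀ s : Fin 2 → Fin 6, s = ![s 0, s 1] := by
        intro s; funext i; fin_cases i <;> rfl
      rw [ext2 t]
      rcases ht with ⟨h, h'⟩ | ⟨h, h'⟩ | ⟨h, h'⟩ | ⟨h, h'⟩ <;> rw [h, h']
      · convert h1 using 1; funext i; fin_cases i <;> rfl
      · convert h2 using 1; funext i; fin_cases i <;> rfl
      · convert h3 using 1; funext i; fin_cases i <;> rfl
      · convert h4 using 1; funext i; fin_cases i <;> rfl
  · intro i
    obtain rfl : i = 0 := Subsingleton.elim _ _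
    rfl

/-- Rank of an element. -/
def rk {m : ℕ} : Option (Fin m) → ℕ
  | none => 0
  | some a => a

/-- Rank of the smallest element of a fact. -/
def mu {m : ℕ} : PStruct.Fact (DD m) → ℕ
  | ⟨.P, t⟩ => rk (t.1 (0 : Fin 1))
  | ⟨.R, t⟩ => min (rk (t.1 (0 : Fin 2))) (rk (t.1 (1 : Fin 2)))

theorem mu_le {m : ℕ} (o : Occ (DD m)) : mu o.fact ≤ rk (m := m) o.elem := by
  obtain ⟨Rl, t, i⟩ := o
  cases Rl with
  | P =>
    change Fin 1 at i
    obtain rfl : i = 0 := Subsingleton.elim _ _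
    exact le_refl _
  | R =>
    change Fin 2 at i
    fin_cases i
    · exact min_le_left _ _
    · exact min_le_right _ _

theorem occ_eq_of_fact {m : ℕ} (o o' : Occ (DD m)) (h : o.fact = o'.fact)
    (h1 : rk (m := m) o.elem = mu o.fact) (h2 : rk (m := m) o'.elem = mu o'.fact) : o = o' := by
  obtain ⟨Rl, t, i⟩ := o
  obtain ⟨Rl', t', i'⟩ := o'
  obtain ⟨rfl, ht⟩ := Sigma.mk.inj h
  obtain rfl := eq_of_heq ht
  suffices i = i' by rw [this]
  cases Rl with
  | P => exact Subsingleton.elim (α := Fin 1) _ _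
  | R =>
    obtain ⟨t, ⟨a, b, ha, hb, hab⟩⟩ := t
    have hne := EE_ne hab
    change rk (t i) = min (rk (t (0 : Fin 2))) (rk (t (1 : Fin 2))) at h1
    change rk (t i') = min (rk (t (0 : Fin 2))) (rk (t (1 : Fin 2))) at h2
    rw [ha, hb] at h1 h2
    change Fin 2 at i
    change Fin 2 at i'
    fin_cases i <;> fin_cases i' <;> simp [ha, hb, rk] at h1 h2 ⊢ <;> omega

theorem occ_eq_of_elem {m : ℕ} (o o' : Occ (DD m)) (h : o.elem = o'.elem)
    (h1 : mu o.fact < rk (m := m) o.elem) (h2 : mu o'.fact < rk (m := m) o'.elem) : o = o' := by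
  obtain ⟨Rl, t, i⟩ := o
  obtain ⟨Rl', t', i'⟩ := o'
  cases Rl with
  | P =>
    exfalso
    obtain rfl : i = (0 : Fin 1) := Subsingleton.elim (α := Fin 1) _ _
    exact lt_irrefl _ h1
  | R =>
  cases Rl' with
  | P =>
    exfalso
    obtain rfl : i' = (0 : Fin 1) := Subsingleton.elim (α := Fin 1) _ _
    exact lt_irrefl _ h2
  | R =>
    obtain ⟨t, ⟨a, b, ha, hb, hab⟩⟩ := t
    obtain ⟨t', ⟨a', b', ha', hb', hab'⟩⟩ := t'
    change min (rk (t (0 : Fin 2))) (rk (t (1 : Fin 2))) < rk (t i) at h1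
    change min (rk (t' (0 : Fin 2))) (rk (t' (1 : Fin 2))) < rk (t' i') at h2
    change t i = t' i' at h
    rw [ha, hb] at h1
    rw [ha', hb'] at h2
    change Fin 2 at i
    change Fin 2 at i'
    have hfin : a = a' → b = b' → t = t' := by
      intro e1 e2
      funext j
      change Fin 2 at j
      fin_cases j
      · change t 0 = t' 0
        rw [ha, ha', e1]
      · change t 1 = t' 1
        rw [hb, hb', e2]
    fin_cases i <;> fin_cases i' <;> simp only [Fin.zero_eta, Fin.mk_one] at h h1 h2 ⊢
    · have e : a = a' := Option.some.inj (ha.symm.trans (h.trans ha'))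
      simp only [ha, ha', rk, inf_lt_left, not_le] at h1 h2
      subst e
      have := hfin rfl (Fin.ext (EE_parent (.inr hab) (.inr hab') h1 h2))
      subst this; rfl
    · exfalso
      have e : a = b' := Option.some.inj (ha.symm.trans (h.trans hb'))
      simp only [ha, hb', rk, inf_lt_left, inf_lt_right, not_le] at h1 h2
      subst e
      have := EE_parent (.inr hab) (.inl hab') h1 h2
      rw [← this] at hab'
      exact EE_asymm hab hab'
    · exfalso
      have e : b = a' := Option.some.inj (hb.symm.trans (h.trans ha'))
      simp only [hb, ha', rk, inf_lt_left, inf_lt_right, not_le] at h1 h2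
      subst e
      have := EE_parent (.inl hab) (.inr hab') h1 h2
      rw [← this] at hab'
      exact EE_asymm hab hab'
    · have e : b = b' := Option.some.inj (hb.symm.trans (h.trans hb'))
      simp only [hb, hb', rk, inf_lt_right, not_le] at h1 h2
      subst e
      have := hfin (Fin.ext (EE_parent (.inl hab) (.inl hab') h1 h2)) rfl
      subst this; rfl

/-- Rank of a vertex of the incidence graph. -/
def irk {m : ℕ} : IncV (DD m) → ℕ
  | .inl x => 4 * rk (m := m) x
  | .inr (.inl o) => if rk (m := m) o.elem = mu o.fact then 4 * mu o.fact + 1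
      else 4 * mu o.fact + 3
  | .inr (.inr f) => 4 * mu f + 2

theorem DD_acyclic (m : ℕ) : Acyclic (DD m) := by
  refine acyclic_of_rank _ irk ?_ ?_
  · rintro u v ⟨o, (⟨rfl, rfl⟩ | ⟨rfl, rfl⟩ | ⟨rfl, rfl⟩ | ⟨rfl, rfl⟩)⟩ <;>
    · simp only [irk]
      split_ifs <;> omega
  · rintro u v w ⟨o, ho⟩ ⟨o', ho'⟩ hv hw
    have hm := mu_le o
    have hm' := mu_le o'
    rcases ho with (⟨rfl, rfl⟩ | ⟨rfl, rfl⟩ | ⟨rfl, rfl⟩ | ⟨rfl, rfl⟩) <;>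
      rcases ho' with (⟨h1, rfl⟩ | ⟨rfl, h2⟩ | ⟨h1, rfl⟩ | ⟨rfl, h2⟩)
    · have e : o.elem = o'.elem := Sum.inl.inj h1
      rw [h1] at hw
      simp only [irk] at hv hw
      rw [occ_eq_of_elem o o' e]
      · split_ifs at hv <;> omega
      · split_ifs at hw <;> omega
    · exact absurd h2 (by intro h; cases h)
    · exact absurd h1 (by intro h; cases h)
    · exact absurd h2 (by intro h; cases h)
    · exact absurd h1 (by intro h; cases h)
    · obtain rfl := Sum.inl.inj (Sum.inr.inj h2)
      rfl
    · exfalso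
      obtain rfl := Sum.inl.inj (Sum.inr.inj h1)
      simp only [irk] at hv hw
      split_ifs at hv hw <;> omega
    · exact absurd h2 (by intro h; cases h)
    · exact absurd h1 (by intro h; cases h)
    · exfalso
      obtain rfl := Sum.inl.inj (Sum.inr.inj h2)
      simp only [irk] at hv hw
      split_ifs at hv hw <;> omega
    · obtain rfl := Sum.inl.inj (Sum.inr.inj h1)
      rfl
    · exact absurd h2 (by intro h; cases h)
    · exact absurd h1 (by intro h; cases h)
    · exact absurd h2 (by intro h; cases h)
    · exact absurd h1 (by intro h; cases h)
    · have e : o.fact = o'.fact := Sum.inr.inj (Sum.inr.inj h2)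
      rw [h2] at hw
      simp only [irk] at hv hw
      rw [occ_eq_of_fact o o' e]
      · split_ifs at hv <;> omega
      · split_ifs at hw <;> omega

instance : Finite Sch15 := by
  refine Finite.of_injective (fun s : Sch15 => match s with | .P => true | .R => false) ?_
  intro a b h
  cases a <;> cases b <;> simp_all

theorem finite_incV (E : PStruct Sch15 arSch15 1) : Finite (IncV E) := by
  have h1 : Finite (Occ E) := by unfold Occ; infer_instance
  have h2 : Finite (PStruct.Fact E) := by unfold PStruct.Fact; infer_instance
  unfold IncV
  infer_instance

/-- Vertices on the main zigzag line. -/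
def ln (i : ℕ) : ℕ := 4 * (i / 2) + i % 2

theorem ln_lt {i n : ℕ} (h : i ≤ 2 * n) : ln i + 3 < 4 * n + 4 + i % 2 * 2 := by
  unfold ln; omega

theorem ln_lt' {i n : ℕ} (h : i ≤ 2 * n) : ln i < 4 * n + 4 := by
  have := ln_lt h
  omega

theorem ln_mod (i : ℕ) : i % 4 = 0 ∧ ln i % 8 = 0 ∧ ln (i + 1) = ln i + 1 ∨
    i % 4 = 1 ∧ ln i % 8 = 1 ∧ ln (i + 1) = ln i + 3 ∨
    i % 4 = 2 ∧ ln i % 8 = 4 ∧ ln (i + 1) = ln i + 1 ∨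
    i % 4 = 3 ∧ ln i % 8 = 5 ∧ ln (i + 1) = ln i + 3 := by
  unfold ln
  have h : i % 4 = 0 ∨ i % 4 = 1 ∨ i % 4 = 2 ∨ i % 4 = 3 := by omega
  rcases h with h | h | h | h
  · exact .inl (by omega)
  · exact .inr (.inl (by omega))
  · exact .inr (.inr (.inl (by omega)))
  · exact .inr (.inr (.inr (by omega)))

theorem EE_ln_fwd {i : ℕ} (h : i % 4 = 0 ∨ i % 4 = 3) : EE (ln i) (ln (i + 1)) := by
  rcases ln_mod i with h1 | h1 | h1 | h1
  · exact .inr (.inr (.inl (by omega)))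
  · omega
  · omega
  · exact .inr (.inr (.inr (.inr (.inr (.inr (.inr (by omega)))))))

theorem EE_ln_rev {i : ℕ} (h : i % 4 = 1 ∨ i % 4 = 2) : EE (ln (i + 1)) (ln i) := by
  rcases ln_mod i with h1 | h1 | h1 | h1
  · omega
  · exact .inr (.inr (.inr (.inl (by omega))))
  · exact .inr (.inr (.inr (.inr (.inr (.inr (.inl (by omega)))))))
  · omega

theorem not_DD_to (E : PStruct Sch15 arSch15 1) (hac : Acyclic E) (hT : ¬ HomTo Tq' E) (n : ℕ)
    (hn : Nat.card (IncV E) ≤ n) : ¬ HomTo (DD (4 * n + 4)) E := by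
  rintro ⟨g, hg, hgd⟩
  have hP : (fun _ => E.dist 0) ∈ E.facts .P := by
    have := hg .P (fun _ => none) rfl
    rw [← hgd 0]
    exact this
  have hT' : ∀ a b c d e : E.dom, (![a, b] : Fin 2 → E.dom) ∈ E.facts .R →
    (![b, c] : Fin 2 → E.dom) ∈ E.facts .R → (![c, d] : Fin 2 → E.dom) ∈ E.facts .R →
    (![d, e] : Fin 2 → E.dom) ∈ E.facts .R → False :=
    fun a b c d e h1 h2 h3 h4 => hT (Tq_to hP h1 h2 h3 h4)
  let G : ℕ → E.dom := fun a => if h : a < 4 * n + 4 then g (some ⟨a, h⟩) else E.dist 0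
  have hG : ∀ a b, a < 4 * n + 4 → b < 4 * n + 4 → EE a b →
      (![G a, G b] : Fin 2 → E.dom) ∈ E.facts .R := by
    intro a b ha hb hab
    have := hg .R ![some ⟨a, ha⟩, some ⟨b, hb⟩] ⟨⟨a, ha⟩, ⟨b, hb⟩, rfl, rfl, hab⟩
    convert this using 1
    funext i
    change Fin 2 at i
    fin_cases i
    · change G a = g (some ⟨a, ha⟩)
      simp only [G, dif_pos ha]
    · change G b = g (some ⟨b, hb⟩)
      simp only [G, dif_pos hb]
  clear_value G
  -- facts along the line
  have hline : ∀ i, ∃ (f : {t : Fin 2 → E.dom // t ∈ E.facts .R}) (q : Fin 2), i < 2 * n →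
      (f.1 q = G (ln i) ∧ f.1 (1 - q) = G (ln (i + 1))) ∧
      ((i % 4 = 0 ∨ i % 4 = 3) ∧ q = 0 ∨ (i % 4 = 1 ∨ i % 4 = 2) ∧ q = 1) := by
    intro i
    by_cases hi : i < 2 * n
    · by_cases h : i % 4 = 0 ∨ i % 4 = 3
      · refine ⟨⟨_, hG (ln i) (ln (i + 1)) (ln_lt' (by omega)) (ln_lt' (by omega))
          (EE_ln_fwd h)⟩, 0, fun _ => ⟨⟨rfl, rfl⟩, .inl ⟨h, rfl⟩⟩⟩
      · refine ⟨⟨_, hG (ln (i + 1)) (ln i) (ln_lt' (by omega)) (ln_lt' (by omega))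
          (EE_ln_rev (by omega))⟩, 1, fun _ => ⟨⟨rfl, rfl⟩, .inr ⟨by omega, rfl⟩⟩⟩
    · exact ⟨⟨_, hG 0 1 (by omega) (by omega) (.inr (.inr (.inl (by omega))))⟩, 0, fun h => absurd h hi⟩
  choose f q hfq using hline
  -- consecutive facts differ
  have hff : ∀ i, i + 1 < 2 * n → f i ≠ f (i + 1) := by
    intro i hi heq
    obtain ⟨⟨a1, a2⟩, a3⟩ := hfq i (by omega)
    obtain ⟨⟨b1, b2⟩, b3⟩ := hfq (i + 1) hi
    rw [← heq] at b1 b2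
    by_cases hpar : i % 2 = 0
    · -- middle vertex is of type q : the two ends coincide
      have hq : q i = 1 - q (i + 1) := by
        rcases a3 with ⟨a, e⟩ | ⟨a, e⟩ <;> rcases b3 with ⟨b, e'⟩ | ⟨b, e'⟩ <;> rw [e, e'] <;>
          first | rfl | omega
      rw [← hq, a1] at b2
      have key : ∀ x y, x < 4 * n + 4 → y < 4 * n + 4 → x % 8 = 0 → y % 8 = 4 →
          x + 3 < 4 * n + 4 → y + 3 < 4 * n + 4 → G x = G y → False := by
        intro x y hx hy hx8 hy8 hx3 hy3 hxy
        have c1 := hG (x + 3) (x + 2) (by omega) (by omega) (.inl (by omega))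
        have c2 := hG (x + 2) x (by omega) (by omega) (.inr (.inl (by omega)))
        have c3 := hG y (y + 2) (by omega) (by omega)
          (.inr (.inr (.inr (.inr (.inr (.inl (by omega)))))))
        have c4 := hG (y + 2) (y + 3) (by omega) (by omega)
          (.inr (.inr (.inr (.inr (.inl (by omega))))))
        rw [← hxy] at c3
        exact hT' _ _ _ _ _ c1 c2 c3 c4
      have l1 := ln_lt (i := i) (n := n) (by omega)
      have l2 := ln_lt (i := i + 1 + 1) (n := n) (by omega)
      have l3 : (i + 1 + 1) % 2 = 0 := by omega
      rw [hpar] at l1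
      rw [l3] at l2
      by_cases h4 : i % 4 = 0
      · have m1 : ln i % 8 = 0 := by have := ln_mod i; omega
        have m2 : ln (i + 1 + 1) % 8 = 4 := by have := ln_mod (i + 1 + 1); omega
        exact key (ln i) (ln (i + 1 + 1)) (by omega) (by omega) m1 m2 (by omega) (by omega) b2
      · have m1 : ln i % 8 = 4 := by have := ln_mod i; omega
        have m2 : ln (i + 1 + 1) % 8 = 0 := by have := ln_mod (i + 1 + 1); omega
        exact key (ln (i + 1 + 1)) (ln i) (by omega) (by omega) m2 m1 (by omega) (by omega) b2.symm
    · -- middle vertex of type p or r : loop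
      have hq : q i = q (i + 1) := by
        rcases a3 with ⟨a, e⟩ | ⟨a, e⟩ <;> rcases b3 with ⟨b, e'⟩ | ⟨b, e'⟩ <;> rw [e, e'] <;>
          omega
      have e : (f i).1 0 = (f i).1 1 := by
        rw [← hq, ← a2] at b1
        generalize q i = z at b1
        fin_cases z
        · exact b1
        · exact b1.symm
      have c := (f i).2
      have c' : (![(f i).1 0, (f i).1 0] : Fin 2 → E.dom) ∈ E.facts .R := by
        convert c using 1
        funext j
        change Fin 2 at j
        fin_cases j
        · rfl
        · exact e
      exact hT' _ _ _ _ _ c' c' c' c'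
  let v : ℕ → IncV E := fun k =>
    if k % 4 = 0 then .inl (G (ln (k / 4)))
    else if k % 4 = 1 then .inr (.inl ⟨.R, f (k / 4), q (k / 4)⟩)
    else if k % 4 = 2 then .inr (.inr ⟨.R, f (k / 4)⟩)
    else .inr (.inl ⟨.R, f (k / 4), 1 - q (k / 4)⟩)
  have v0 : ∀ i, v (4 * i) = .inl (G (ln i)) := by
    intro i
    have h1 : (4 * i) % 4 = 0 := by omega
    have h2 : (4 * i) / 4 = i := by omega
    simp only [v, h1, h2]; rfl
  have v1 : ∀ i, v (4 * i + 1) = .inr (.inl ⟨.R, f i, q i⟩) := by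
    intro i
    have h1 : (4 * i + 1) % 4 = 1 := by omega
    have h2 : (4 * i + 1) / 4 = i := by omega
    simp only [v, h1, h2]; rfl
  have v2 : ∀ i, v (4 * i + 2) = .inr (.inr ⟨.R, f i⟩) := by
    intro i
    have h1 : (4 * i + 2) % 4 = 2 := by omega
    have h2 : (4 * i + 2) / 4 = i := by omega
    simp only [v, h1, h2]; rfl
  have v3 : ∀ i, v (4 * i + 3) = .inr (.inl ⟨.R, f i, 1 - q i⟩) := by
    intro i
    have h1 : (4 * i + 3) % 4 = 3 := by omega
    have h2 : (4 * i + 3) / 4 = i := by omega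
    simp only [v, h1, h2]; rfl
  clear_value v
  have := finite_incV E
  have hlt := seq_lt_card (incGraph E) hac (4 * (2 * n)) v ?_ ?_
  · omega
  · intro k hk
    obtain ⟨i, hi⟩ : ∃ i, k = 4 * i ∨ k = 4 * i + 1 ∨ k = 4 * i + 2 ∨ k = 4 * i + 3 :=
      ⟨k / 4, by omega⟩
    obtain ⟨⟨a1, a2⟩, a3⟩ := hfq i (by omega)
    rcases hi with rfl | rfl | rfl | rfl
    · rw [v0, v1]
      refine ⟨⟨.R, f i, q i⟩, .inl ⟨?_, rfl⟩⟩
      rw [← a1]; rfl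
    · rw [v1, v2]
      exact ⟨⟨.R, f i, q i⟩, .inr (.inr (.inl ⟨rfl, rfl⟩))⟩
    · rw [v2, v3]
      exact ⟨⟨.R, f i, 1 - q i⟩, .inr (.inr (.inr ⟨rfl, rfl⟩))⟩
    · rw [v3, show 4 * i + 3 + 1 = 4 * (i + 1) by ring, v0]
      refine ⟨⟨.R, f i, 1 - q i⟩, .inr (.inl ⟨?_, rfl⟩)⟩
      rw [← a2]; rfl
  · intro k hk
    obtain ⟨i, hi⟩ : ∃ i, k = 4 * i ∨ k = 4 * i + 1 ∨ k = 4 * i + 2 ∨ k = 4 * i + 3 :=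
      ⟨k / 4, by omega⟩
    rcases hi with rfl | rfl | rfl | rfl
    · rw [v0, v2]
      intro h; cases h
    · rw [v1, show 4 * i + 1 + 2 = 4 * i + 3 by ring, v3]
      intro h
      have h' := Sum.inl.inj (Sum.inr.inj h)
      have h'' := congrArg Prod.snd (eq_of_heq (Sigma.mk.inj h').2)
      change q i = 1 - q i at h''
      generalize q i = z at h''
      revert h''
      revert z
      decide
    · rw [v2, show 4 * i + 2 + 2 = 4 * (i + 1) by ring, v0]
      intro h; cases h
    · rw [v3, show 4 * i + 3 + 2 = 4 * (i + 1) + 1 by ring, v1]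
      intro h
      have h' := Sum.inl.inj (Sum.inr.inj h)
      have h'' := congrArg Prod.fst (eq_of_heq (Sigma.mk.inj h').2)
      exact hff i (by omega) h''

theorem HomTo_trans {A B C : PStruct Sch15 arSch15 1} (h : HomTo A B) (h' : HomTo B C) :
    HomTo A C := by
  obtain ⟨f, hf, hf'⟩ := h
  obtain ⟨g, hg, hg'⟩ := h'
  exact ⟨fun x => g (f x), fun S t ht => hg S _ (hf S t ht), fun i =>
    (congrArg g (hf' i)).trans (hg' i)⟩

/-- The unary acyclic query `T'` is not uniquely characterizable, w.r.t. the class of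
unary acyclic CQs, by any finite set of acyclic positive and negative examples. -/
theorem stmt_15 :
    ¬ ∃ Ep Em : Set (PStruct Sch15 arSch15 1),
        Ep.Finite ∧ Em.Finite ∧ (∀ E ∈ Ep ∪ Em, Acyclic E) ∧
        UniquelyCharacterizes Ep Em Tq'
          {Q : PStruct Sch15 arSch15 1 | IsCQ Q ∧ Acyclic Q} := by
  rintro ⟨Ep, Em, -, hfin, hac, ⟨hp, hm⟩, huniq⟩
  obtain ⟨n, hn⟩ : ∃ n, ∀ E ∈ Em, Nat.card (IncV E) ≤ n := by
    obtain ⟨n, hn⟩ := (hfin.image (fun E => Nat.card (IncV E))).bddAbove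
    exact ⟨n, fun E hE => hn ⟨E, hE, rfl⟩⟩
  refine not_Tq_to_DD (4 * n + 4) (huniq (DD (4 * n + 4)) ⟨DD_isCQ n, DD_acyclic _⟩ ⟨?_, ?_⟩).1
  · intro E hE
    exact HomTo_trans (DD_to_Tq _) (hp E hE)
  · intro E hE
    exact not_DD_to E (hac E (.inr hE)) (hm E hE) n (hn E hE)
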